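/- Let q and n be positive integers and let S_q denote the subgroup of S_{n+q−1} consisting of permutations fixing every point larger than q (the subgroup generated by s_1,…,s_{q−1}). If π and σ in S_{n+q−1} lie in the same double coset of S_q, i.e. π ∈ S_q σ S_q, then: (1) Del_q(π) = Del_q(σ); (2) Des_q(π) = Des_q(σ); (3) inv_q(π) = inv_q(σ). -/

import Mathlib

open Finset

/-- The Coxeter generator `s_j = (j, j+1)` of the symmetric group on `{1,…,m}`,
viewed as a permutation of `ℕ` (with 1-based positions). -/
def sgen (j : ℕ) : Equiv.Perm ℕ := Equiv.swap j (j + 1)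

/-- The permutation determined by a word in the Coxeter generators,
letters read from left to right and composed as functions. -/
def wordPerm (L : List ℕ) : Equiv.Perm ℕ := (L.map sgen).prod

/-- The canonical presentation of a permutation of `{1,…,m}` (given as a permutation of `ℕ`
supported on `{1,…,m}`): the unique factorization `w = w₁ w₂ ⋯ w_{m-1}` with
`w_j ∈ R_j = {1, s_j, s_j s_{j-1}, …, s_j ⋯ s_1}`, recorded as the list of indices of the
Coxeter generators appearing, read from left to right. -/
def canonWord : ℕ → Equiv.Perm ℕ → List ℕ
  | 0, _ => []
  | m + 1, π =>
      canonWord m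
          (π * (wordPerm ((List.range' (π⁻¹ (m + 1)) (m + 1 - π⁻¹ (m + 1))).reverse))⁻¹)
        ++ (List.range' (π⁻¹ (m + 1)) (m + 1 - π⁻¹ (m + 1))).reverse

def finIccEquiv (m : ℕ) : Fin m ≃ {i : ℕ // i ∈ Finset.Icc 1 m} where
  toFun a := ⟨a.1 + 1, by have := a.isLt; simp only [Finset.mem_Icc]; omega⟩
  invFun b := ⟨b.1 - 1, by have := b.2; simp only [Finset.mem_Icc] at this; omega⟩
  left_inv a := by ext; simp
  right_inv b := by
    have := b.2
    simp only [Finset.mem_Icc] at this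
    ext
    simp only []
    omega

/-- A permutation of `{1,…,m}`, i.e. of `Fin m`, viewed as a permutation of `ℕ`
(moving only the points `1,…,m`, with `i ∈ Fin m` corresponding to the point `i+1`). -/
def natPerm {m : ℕ} (π : Equiv.Perm (Fin m)) : Equiv.Perm ℕ :=
  π.extendDomain (finIccEquiv m)

/-- `Del_q` of a permutation of `{1,…,m}`: the set of positions `q+1 ≤ i ≤ m` that are
`(q-1)`-st almost left-to-right minima, i.e. `#{j < i : π(j) < π(i)} ≤ q - 1`. -/
def DelQ (q m : ℕ) (π : Equiv.Perm ℕ) : Finset ℕ :=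
  (Finset.Icc (q + 1) m).filter fun i =>
    ((Finset.Ico 1 i).filter fun j => π j < π i).card ≤ q - 1

/-- The descent set of a permutation of `{1,…,m}`: positions `1 ≤ i ≤ m-1` with `π(i) > π(i+1)`. -/
def DesSet (m : ℕ) (π : Equiv.Perm ℕ) : Finset ℕ :=
  (Finset.Icc 1 (m - 1)).filter fun i => π (i + 1) < π i

/-- `Des_q(π) = (Des(π) ∩ {q,…,m-1}) ∪ (Del_q(π) - 1)`. -/
def DesQ (q m : ℕ) (π : Equiv.Perm ℕ) : Finset ℕ :=
  DesSet m π ∩ Finset.Icc q (m - 1) ∪ (DelQ q m π).image (fun i => i - 1)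

/-- The `q`-inversion number of a permutation of `{1,…,m}`:
`inv_q(π) = Σ_{i=q+1}^m min(i-q, #{j < i : π(j) > π(i)})`. -/
def invQ (q m : ℕ) (π : Equiv.Perm ℕ) : ℕ :=
  ∑ i ∈ Finset.Icc (q + 1) m,
    min (i - q) ((Finset.Ico 1 i).filter fun j => π i < π j).card

/-- The `q`-reverse major index `rmaj_{q,m}(π) = Σ_{i ∈ Des_q(π)} (m - i)`. -/
def rmajQ (q m : ℕ) (π : Equiv.Perm ℕ) : ℕ :=
  ∑ i ∈ DesQ q m π, (m - i)

/-- The `q`-length of a permutation of `{1,…,m}`: the number of letters in the canonical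
presentation, where the generators `s_1, …, s_{q-1}` are not counted. -/
def ellQ (q m : ℕ) (π : Equiv.Perm ℕ) : ℕ :=
  ((canonWord m π).filter fun j => q ≤ j).length

/-- `del_q` of a permutation of `{1,…,m}`: the number of occurrences of the generator `s_q`
in the canonical presentation. -/
def delq (q m : ℕ) (π : Equiv.Perm ℕ) : ℕ := (canonWord m π).count q

/-- The covering map `f_q : S_m → S_{m-q+1}`, defined on the canonical presentation by
`s_j ↦ 1` if `j ≤ q-1` and `s_j ↦ s_{j-q+1}` if `j ≥ q`. -/
def fq (q m : ℕ) (π : Equiv.Perm ℕ) : Equiv.Perm ℕ :=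
  wordPerm (((canonWord m π).filter fun j => q ≤ j).map fun j => j - q + 1)

/-- A permutation of `{1,…,m}` avoids the pattern set `Pat(q)` iff there is no sequence
`1 ≤ i₁ < i₂ < ⋯ < i_{q+1} < m` with `π(i_{q+1}) > π(i_{q+1}+1)` and
`π(i_j) < π(i_{q+1}+1)` for all `1 ≤ j ≤ q`. -/
def AvoidsPat (q m : ℕ) (π : Equiv.Perm ℕ) : Prop :=
  ¬ ∃ f : Fin (q + 1) → ℕ, StrictMono f ∧ 1 ≤ f 0 ∧ f (Fin.last q) < m ∧
      π (f (Fin.last q) + 1) < π (f (Fin.last q)) ∧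
      ∀ a : Fin (q + 1), a ≠ Fin.last q → π (f a) < π (f (Fin.last q) + 1)

/-- The Stirling number of the second kind `S(n,k)`: the number of partitions of
`{1,…,n}` into `k` nonempty blocks. -/
noncomputable def stirling2 (n k : ℕ) : ℕ :=
  Nat.card {P : Finpartition (Finset.univ : Finset (Fin n)) // P.parts.card = k}

/-- The `q`-Bell number `b_q(n) = Σ_k q^k S(n,k)`. -/
noncomputable def qBell (q n : ℕ) : ℕ := ∑ k ∈ Finset.range (n + 1), q ^ k * stirling2 n k

/-- `h_q(m)`: the number of permutations of `{1,…,m}` avoiding all patterns in `Pat(q)`. -/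
noncomputable def hq (q m : ℕ) : ℕ :=
  Nat.card {π : Equiv.Perm (Fin m) // AvoidsPat q m (natPerm π)}

/-- The number of cycles (including fixed points) of a permutation of `{1,…,n}`. -/
def cycleCount {n : ℕ} (σ : Equiv.Perm (Fin n)) : ℕ :=
  σ.cycleType.card + (n - σ.support.card)

/-- The signless Stirling number of the first kind `c(n,k)`: the number of permutations
of `{1,…,n}` with exactly `k` cycles. -/
noncomputable def stirling1 (n k : ℕ) : ℕ :=
  Nat.card {σ : Equiv.Perm (Fin n) // cycleCount σ = k}

theorem natPerm_mul {m : ℕ} (π σ : Equiv.Perm (Fin m)) :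
    natPerm (π * σ) = natPerm π * natPerm σ :=
  (Equiv.Perm.extendDomain_mul _ _ _).symm

theorem natPerm_zero {m : ℕ} (π : Equiv.Perm (Fin m)) : natPerm π 0 = 0 :=
  Equiv.Perm.extendDomain_apply_not_subtype _ _ (by simp)

/-- The number of positions `1 ≤ j < i` with `π(j) < π(i)`. -/
def smallerBefore (π : Equiv.Perm ℕ) (i : ℕ) : ℕ :=
  ((Finset.Ico 1 i).filter fun j => π j < π i).card

theorem smallerBefore_lt {π : Equiv.Perm ℕ} (h0 : π 0 = 0) {i : ℕ} (hi : 0 < i) :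
    smallerBefore π i < π i := by
  have hpos : ∀ j, 0 < j → 0 < π j := fun j hj => by
    refine Nat.pos_of_ne_zero fun h => hj.ne' (π.injective (h.trans h0.symm))
  have hle : smallerBefore π i ≤ (Finset.Ico 1 (π i)).card := by
    refine Finset.card_le_card_of_injOn π (fun j hj => ?_) π.injective.injOn
    simp only [Finset.coe_filter, Set.mem_ofPred_eq, Finset.mem_Ico] at hj
    simp only [Finset.coe_Ico, Set.mem_Ico]
    exact ⟨hpos j hj.1.1, hj.2⟩
  have := hpos i hi
  rw [Nat.card_Ico] at hle
  omega

theorem smallerBefore_add_card_greater (π : Equiv.Perm ℕ) (i : ℕ) :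
    smallerBefore π i + ((Finset.Ico 1 i).filter fun j => π i < π j).card = i - 1 := by
  have h := Finset.card_filter_add_card_filter_not (s := Finset.Ico 1 i) (fun j => π j < π i)
  rw [Nat.card_Ico] at h
  rw [← h, smallerBefore]
  congr 2
  refine Finset.filter_congr fun j hj => ?_
  have hne : π j ≠ π i := fun he => (Finset.mem_Ico.1 hj).2.ne (π.injective he)
  omega

theorem lt_apply_iff_of_fix {q : ℕ} {a : Equiv.Perm ℕ} (ha : ∀ i, q < i → a i = i) (x : ℕ) :
    q < a x ↔ q < x := by
  refine ⟨fun h => ?_, fun h => by rwa [ha x h]⟩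
  rwa [← a.injective (ha _ h)]

theorem apply_lt_iff_of_fix {q : ℕ} {a : Equiv.Perm ℕ} (ha : ∀ i, q < i → a i = i)
    {x y : ℕ} (hy : q < y) : a x < y ↔ x < y := by
  by_cases hx : q < x
  · rw [ha x hx]
  · have := (lt_apply_iff_of_fix ha x).not.2 hx
    omega

theorem lt_apply_iff_of_fix_of_lt {q : ℕ} {a : Equiv.Perm ℕ} (ha : ∀ i, q < i → a i = i)
    {x y : ℕ} (hy : q < y) : y < a x ↔ y < x := by
  by_cases hx : q < x
  · rw [ha x hx]
  · have := (lt_apply_iff_of_fix ha x).not.2 hx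
    omega

theorem smallerBefore_mul_right {q : ℕ} {b : Equiv.Perm ℕ} (hb : ∀ i, q < i → b i = i)
    (hb0 : b 0 = 0) (σ : Equiv.Perm ℕ) {i : ℕ} (hi : q < i) :
    smallerBefore (σ * b) i = smallerBefore σ i := by
  refine Finset.card_equiv b fun j => ?_
  have h0 : 1 ≤ j ↔ 1 ≤ b j := by
    have : b j = 0 ↔ j = 0 := by rw [← b.injective.eq_iff (a := j), hb0]
    omega
  simp only [Finset.mem_filter, Finset.mem_Ico, Equiv.Perm.mul_apply, hb i hi,
    apply_lt_iff_of_fix hb hi, h0]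

theorem smallerBefore_mul_left {q : ℕ} {a : Equiv.Perm ℕ} (ha : ∀ i, q < i → a i = i)
    (σ : Equiv.Perm ℕ) {i : ℕ} (hi : q < σ i) :
    smallerBefore (a * σ) i = smallerBefore σ i := by
  simp only [smallerBefore, Equiv.Perm.mul_apply, ha _ hi, apply_lt_iff_of_fix ha hi]

/-- Beyond position `q`, multiplying on both sides by permutations fixing all points larger
than `q` preserves `smallerBefore`, except where it is less than `q` on both sides. -/
theorem smallerBefore_mul_mul {q : ℕ} {a b σ : Equiv.Perm ℕ} (ha : ∀ i, q < i → a i = i)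
    (hb : ∀ i, q < i → b i = i) (ha0 : a 0 = 0) (hb0 : b 0 = 0) (hσ0 : σ 0 = 0)
    {i : ℕ} (hi : q < i) :
    smallerBefore (a * σ * b) i = smallerBefore σ i ∨
      smallerBefore (a * σ * b) i < q ∧ smallerBefore σ i < q := by
  rw [smallerBefore_mul_right hb hb0 _ hi]
  by_cases hσ : q < σ i
  · exact Or.inl (smallerBefore_mul_left ha σ hσ)
  · have h1 := smallerBefore_lt hσ0 (Nat.zero_lt_of_lt hi)
    have h2 := smallerBefore_lt (π := a * σ) (by simp [hσ0, ha0]) (Nat.zero_lt_of_lt hi)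
    have h3 : ¬ q < (a * σ) i := (lt_apply_iff_of_fix ha (σ i)).not.2 hσ
    exact Or.inr ⟨by omega, by omega⟩

theorem mem_DelQ_iff {q m : ℕ} (hq : 0 < q) (π : Equiv.Perm ℕ) (i : ℕ) :
    i ∈ DelQ q m π ↔ (q < i ∧ i ≤ m) ∧ smallerBefore π i < q := by
  simp only [DelQ, smallerBefore, Finset.mem_filter, Finset.mem_Icc, Nat.succ_le_iff,
    Nat.le_sub_one_iff_lt hq]

/-- A descent at position `q` is always accompanied by `q + 1 ∈ Del_q`. -/
theorem smallerBefore_succ_lt_of_descent {q : ℕ} (hq : 0 < q) {π : Equiv.Perm ℕ}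
    (h : π (q + 1) < π q) : smallerBefore π (q + 1) < q := by
  have h1 := smallerBefore_add_card_greater π (q + 1)
  have h2 : 0 < ((Finset.Ico 1 (q + 1)).filter fun j => π (q + 1) < π j).card :=
    Finset.card_pos.2 ⟨q, by simp only [Finset.mem_filter, Finset.mem_Ico]; omega⟩
  omega

theorem mem_DesQ_iff {q m : ℕ} (hq : 0 < q) (π : Equiv.Perm ℕ) (i : ℕ) :
    i ∈ DesQ q m π ↔
      (q ≤ i ∧ i + 1 ≤ m) ∧ (smallerBefore π (i + 1) < q ∨ q < i ∧ π (i + 1) < π i) := by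
  simp only [DesQ, DesSet, Finset.mem_union, Finset.mem_inter, Finset.mem_filter,
    Finset.mem_Icc, Finset.mem_image, mem_DelQ_iff hq]
  constructor
  · rintro (⟨⟨h1, h2⟩, h3⟩ | ⟨j, ⟨h1, h2⟩, rfl⟩)
    · refine ⟨by omega, ?_⟩
      rcases h3.1.eq_or_lt with rfl | hlt
      · exact Or.inl (smallerBefore_succ_lt_of_descent hq h2)
      · exact Or.inr ⟨hlt, h2⟩
    · obtain ⟨k, rfl⟩ : ∃ k, j = k + 1 := ⟨j - 1, by omega⟩
      exact ⟨by omega, Or.inl h2⟩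
  · rintro ⟨h1, h2 | ⟨h2, h3⟩⟩
    · exact Or.inr ⟨i + 1, ⟨by omega, h2⟩, rfl⟩
    · exact Or.inl ⟨⟨by omega, h3⟩, by omega⟩

/-- Let `q` and `n` be positive integers and let `S_q` denote the subgroup of
`S_{n+q-1}` of permutations fixing every point larger than `q`. If `π` and `σ` in `S_{n+q-1}`
lie in the same double coset of `S_q` (i.e. `π ∈ S_q σ S_q`), then
(1) `Del_q(π) = Del_q(σ)`; (2) `Des_q(π) = Des_q(σ)`; (3) `inv_q(π) = inv_q(σ)`. -/
theorem double_coset_invariance (q n : ℕ) (hq : 0 < q) (hn : 0 < n)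
    (π σ : Equiv.Perm (Fin (n + q - 1)))
    (h : ∃ τ₁ τ₂ : Equiv.Perm (Fin (n + q - 1)),
      (∀ i : ℕ, q < i → natPerm τ₁ i = i) ∧ (∀ i : ℕ, q < i → natPerm τ₂ i = i) ∧
      π = τ₁ * σ * τ₂) :
    DelQ q (n + q - 1) (natPerm π) = DelQ q (n + q - 1) (natPerm σ) ∧
    DesQ q (n + q - 1) (natPerm π) = DesQ q (n + q - 1) (natPerm σ) ∧
    invQ q (n + q - 1) (natPerm π) = invQ q (n + q - 1) (natPerm σ) := by
  obtain ⟨τ₁, τ₂, ha, hb, rfl⟩ := h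
  rw [natPerm_mul, natPerm_mul]
  have ha0 := natPerm_zero τ₁
  have hb0 := natPerm_zero τ₂
  have hσ0 := natPerm_zero σ
  generalize natPerm τ₁ = a at *
  generalize natPerm τ₂ = b at *
  generalize natPerm σ = s at *
  have key := fun {i : ℕ} (hi : q < i) => smallerBefore_mul_mul ha hb ha0 hb0 hσ0 hi
  refine ⟨?_, ?_, ?_⟩
  · ext i
    rw [mem_DelQ_iff hq, mem_DelQ_iff hq]
    refine and_congr_right fun hi => ?_
    have := key hi.1
    omega
  · ext i
    rw [mem_DesQ_iff hq, mem_DesQ_iff hq]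
    refine and_congr_right fun hi => ?_
    have hk := key (i := i + 1) (by omega)
    by_cases hd : smallerBefore s (i + 1) < q
    · exact iff_of_true (Or.inl (by omega)) (Or.inl hd)
    · refine or_congr (by omega) (and_congr_right fun hlt => ?_)
      have hs : q < s (i + 1) := by
        have := smallerBefore_lt hσ0 (i := i + 1) (by omega)
        omega
      simp only [Equiv.Perm.mul_apply, hb i hlt, hb (i + 1) (by omega), ha _ hs]
      exact lt_apply_iff_of_fix_of_lt ha hs
  · refine Finset.sum_congr rfl fun i hi => ?_
    have hk := key (i := i) (by simp only [Finset.mem_Icc] at hi; omega)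
    have h1 := smallerBefore_add_card_greater (a * s * b) i
    have h2 := smallerBefore_add_card_greater s i
    omega
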